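/- arXiv:2312.05882 — 4 statements merged into one kernel-verified Lean document; each statement's English description precedes it below -/
import Mathlib

section
/- Let β ∈ (0,1), let ψ : ℝ → ℝ be integrable with integrable Fourier transform ψ̂, and let ν₁, ν₂, ν₃ ∈ (−β, 1−β) satisfy ν₁ + ν₃ < 1 − 2β and ν₂ + ν₃ < 1 − 2β. Then the integral ∫_{ℝ²} |λ₁|^{ν₁+β−1} |λ₂|^{ν₂+β−1} ( ∫_ℝ |ψ̂(λ₁+ξ)| · |ψ̂(λ₂−ξ)| · |ξ|^{−(1−β−ν₃)} dξ )² dλ₁ dλ₂ is finite. -/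
open MeasureTheory Set

/-- The Fourier transform `ψ̂(λ) = ∫ e^{-iuλ} ψ(u) du` of an integrable `ψ : ℝ → ℝ`. -/
noncomputable def Fhat (ψ : ℝ → ℝ) (l : ℝ) : ℂ :=
  ∫ u : ℝ, Complex.exp (-Complex.I * u * l) * (ψ u : ℂ)

/-- The weight `|x| ^ (a - 1)` near the origin, with the decay `|x| ^ (-s)` at infinity. -/
noncomputable def cutoffWeight (a s x : ℝ) : ℝ :=
  if |x| ≤ 1 then |x| ^ (a - 1) else |x| ^ (-s)

theorem cutoffWeight_nonneg (a s x : ℝ) : 0 ≤ cutoffWeight a s x := by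
  unfold cutoffWeight
  split_ifs <;> positivity

theorem measurable_cutoffWeight (a s : ℝ) : Measurable (cutoffWeight a s) := by
  unfold cutoffWeight
  exact Measurable.ite (measurableSet_le (by fun_prop) (by fun_prop)) (by fun_prop) (by fun_prop)

theorem integrableOn_Ici_cutoffWeight {a s : ℝ} (ha : 0 < a) (hs : 1 < s) :
    IntegrableOn (cutoffWeight a s) (Ici 0) := by
  rw [integrableOn_Ici_iff_integrableOn_Ioi, ← Ioc_union_Ioi_eq_Ioi zero_le_one]
  refine IntegrableOn.union ?_ ?_
  · have h := (intervalIntegrable_iff_integrableOn_Ioc_of_le zero_le_one).1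
      (intervalIntegral.intervalIntegrable_rpow' (a := 0) (b := 1) (r := a - 1) (by linarith))
    refine h.congr_fun (fun x hx => ?_) measurableSet_Ioc
    simp [cutoffWeight, abs_of_pos hx.1, hx.2]
  · have h := integrableOn_Ioi_rpow_of_lt (a := -s) (by linarith) zero_lt_one
    refine h.congr_fun (fun x hx => ?_) measurableSet_Ioi
    have hx' : (1 : ℝ) < x := hx
    simp [cutoffWeight, abs_of_pos (zero_lt_one.trans hx'), hx']

theorem lintegral_cutoffWeight_lt_top {a s : ℝ} (ha : 0 < a) (hs : 1 < s) :
    ∫⁻ x, ENNReal.ofReal (cutoffWeight a s x) < ⊤ := by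
  set F : ℝ → ENNReal := fun x => ENNReal.ofReal (cutoffWeight a s x)
  have hF : Measurable F := (measurable_cutoffWeight a s).ennreal_ofReal
  have heven (x : ℝ) : F (-x) = F x := by simp [F, cutoffWeight]
  have hhalf : ∫⁻ x, (Ici 0).indicator F x < ⊤ := by
    rw [lintegral_indicator measurableSet_Ici]
    exact (integrableOn_Ici_cutoffWeight ha hs).lintegral_lt_top
  calc ∫⁻ x, F x ≤ ∫⁻ x, (Ici 0).indicator F x + (Ici 0).indicator F (-x) := by
        refine lintegral_mono fun x => ?_
        rcases le_total 0 x with hx | hx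
        · simp [indicator_of_mem (mem_Ici.2 hx)]
        · rw [indicator_of_mem (mem_Ici.2 (neg_nonneg.2 hx)), heven]
          exact le_add_self
    _ = (∫⁻ x, (Ici 0).indicator F x) + ∫⁻ x, (Ici 0).indicator F x := by
        rw [lintegral_add_left (hF.indicator measurableSet_Ici),
          lintegral_neg_eq_self ((Ici 0).indicator F)]
    _ < ⊤ := ENNReal.add_lt_top.2 ⟨hhalf, hhalf⟩

theorem rpow_abs_mul_rpow_abs_le_cutoffWeight {a b : ℝ} (ha : a < 1) (hb : b < 1) (x y : ℝ) :
    |x| ^ (a - 1) * |y| ^ (b - 1) ≤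
      cutoffWeight a (2 - a - b) x * cutoffWeight b (2 - a - b) y
        + cutoffWeight a (2 - a - b) x + cutoffWeight b (2 - a - b) y := by
  have far {z c : ℝ} (hz : 1 < z) (hc : c < 1) : z ^ (c - 1) ≤ 1 :=
    Real.rpow_le_one_of_one_le_of_nonpos hz.le (by linarith)
  have hx0 := cutoffWeight_nonneg a (2 - a - b) x
  have hy0 := cutoffWeight_nonneg b (2 - a - b) y
  have hxy0 := mul_nonneg hx0 hy0
  have hxp : 0 ≤ |x| ^ (a - 1) := by positivity
  have hyp : 0 ≤ |y| ^ (b - 1) := by positivity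
  have split {z : ℝ} (hz : 1 < z) : z ^ (a - 1) * z ^ (b - 1) = z ^ (-(2 - a - b)) := by
    rw [← Real.rpow_add (by linarith)]
    ring_nf
  rcases le_or_gt |x| 1 with hx | hx <;> rcases le_or_gt |y| 1 with hy | hy
  · have h1 : cutoffWeight a (2 - a - b) x = |x| ^ (a - 1) := if_pos hx
    have h2 : cutoffWeight b (2 - a - b) y = |y| ^ (b - 1) := if_pos hy
    rw [h1, h2]
    linarith
  · have h1 : cutoffWeight a (2 - a - b) x = |x| ^ (a - 1) := if_pos hx
    have := mul_le_of_le_one_right hxp (far hy hb)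
    linarith
  · have h2 : cutoffWeight b (2 - a - b) y = |y| ^ (b - 1) := if_pos hy
    have := mul_le_of_le_one_left hyp (far hx ha)
    linarith
  · have h1 : cutoffWeight a (2 - a - b) x = |x| ^ (-(2 - a - b)) := if_neg hx.not_ge
    have h2 : cutoffWeight b (2 - a - b) y = |y| ^ (-(2 - a - b)) := if_neg hy.not_ge
    rcases le_total |x| |y| with h | h
    · have := mul_le_mul_of_nonneg_left
        (Real.rpow_le_rpow_of_nonpos (by linarith) h (by linarith : b - 1 ≤ 0)) hxp
      rw [split hx, ← h1] at this
      linarith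
    · have := mul_le_mul_of_nonneg_right
        (Real.rpow_le_rpow_of_nonpos (by linarith) h (by linarith : a - 1 ≤ 0)) hyp
      rw [split hy, ← h2] at this
      linarith

/-- A double Riesz potential of a bounded integrable function is finite. -/
theorem lintegral_rpow_abs_mul_lintegral_lt_top {a b : ℝ} (ha0 : 0 < a) (ha : a < 1)
    (hb0 : 0 < b) (hb : b < 1) (hab : a + b < 1) {f : ℝ → ENNReal} (hf : Measurable f)
    {C : ENNReal} (hC : C < ⊤) (hfC : ∀ x, f x ≤ C) (hfint : ∫⁻ x, f x < ⊤) :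
    ∫⁻ x, ENNReal.ofReal (|x| ^ (a - 1)) *
      ∫⁻ y, f (x + y) * ENNReal.ofReal (|y| ^ (b - 1)) < ⊤ := by
  set g : ℝ → ENNReal := fun x => ENNReal.ofReal (cutoffWeight a (2 - a - b) x)
  set h : ℝ → ENNReal := fun y => ENNReal.ofReal (cutoffWeight b (2 - a - b) y)
  have hg : Measurable g := (measurable_cutoffWeight _ _).ennreal_ofReal
  have hh : Measurable h := (measurable_cutoffWeight _ _).ennreal_ofReal
  have hgint : ∫⁻ x, g x < ⊤ := lintegral_cutoffWeight_lt_top ha0 (by linarith)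
  have hhint : ∫⁻ y, h y < ⊤ := lintegral_cutoffWeight_lt_top hb0 (by linarith)
  have hpt (x y : ℝ) : ENNReal.ofReal (|x| ^ (a - 1)) *
      (f (x + y) * ENNReal.ofReal (|y| ^ (b - 1))) ≤
        C * g x * h y + g x * f (x + y) + h y * f (x + y) := by
    have hw : ENNReal.ofReal (|x| ^ (a - 1)) * ENNReal.ofReal (|y| ^ (b - 1)) ≤
        g x * h y + g x + h y := by
      simp only [g, h]
      rw [← ENNReal.ofReal_mul (by positivity), ← ENNReal.ofReal_mul (cutoffWeight_nonneg _ _ _),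
        ← ENNReal.ofReal_add (mul_nonneg (cutoffWeight_nonneg _ _ _) (cutoffWeight_nonneg _ _ _))
          (cutoffWeight_nonneg _ _ _),
        ← ENNReal.ofReal_add (add_nonneg (mul_nonneg (cutoffWeight_nonneg _ _ _)
          (cutoffWeight_nonneg _ _ _)) (cutoffWeight_nonneg _ _ _)) (cutoffWeight_nonneg _ _ _)]
      exact ENNReal.ofReal_le_ofReal (rpow_abs_mul_rpow_abs_le_cutoffWeight ha hb x y)
    calc _ = f (x + y) *
          (ENNReal.ofReal (|x| ^ (a - 1)) * ENNReal.ofReal (|y| ^ (b - 1))) := by ring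
      _ ≤ f (x + y) * (g x * h y + g x + h y) := by gcongr
      _ = f (x + y) * (g x * h y) + g x * f (x + y) + h y * f (x + y) := by ring
      _ ≤ C * (g x * h y) + g x * f (x + y) + h y * f (x + y) := by gcongr; exact hfC _
      _ = _ := by ring
  have hinner (x : ℝ) : ENNReal.ofReal (|x| ^ (a - 1)) *
      ∫⁻ y, f (x + y) * ENNReal.ofReal (|y| ^ (b - 1)) ≤
        C * (∫⁻ y, h y) * g x + (∫⁻ y, f y) * g x + ∫⁻ y, h y * f (x + y) := by
    rw [← lintegral_const_mul _ (by fun_prop)]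
    refine (lintegral_mono (hpt x)).trans_eq ?_
    rw [lintegral_add_left (by fun_prop), lintegral_add_left (by fun_prop),
      lintegral_const_mul _ (by fun_prop), lintegral_const_mul _ (by fun_prop),
      lintegral_add_left_eq_self f x]
    ring
  have hswap : ∫⁻ x, ∫⁻ y, h y * f (x + y) = (∫⁻ y, h y) * ∫⁻ x, f x := by
    rw [lintegral_lintegral_swap (by fun_prop), ← lintegral_mul_const _ hh]
    refine lintegral_congr fun y => ?_
    rw [lintegral_const_mul _ (by fun_prop), lintegral_add_right_eq_self f y]
  refine (lintegral_mono hinner).trans_lt ?_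
  rw [lintegral_add_left (by fun_prop), lintegral_add_left (by fun_prop),
    lintegral_const_mul _ hg, lintegral_const_mul _ hg, hswap]
  exact ENNReal.add_lt_top.2 ⟨ENNReal.add_lt_top.2
    ⟨ENNReal.mul_lt_top (ENNReal.mul_lt_top hC hhint) hgint, ENNReal.mul_lt_top hfint hgint⟩,
    ENNReal.mul_lt_top hhint hfint⟩

theorem norm_exp_neg_I_mul_mul (u l : ℝ) : ‖Complex.exp (-Complex.I * u * l)‖ = 1 := by
  simp [Complex.norm_exp]

theorem norm_Fhat_le (ψ : ℝ → ℝ) (l : ℝ) : ‖Fhat ψ l‖ ≤ ∫ u, ‖ψ u‖ := by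
  refine (norm_integral_le_integral_norm _).trans_eq ?_
  simp only [norm_mul, norm_exp_neg_I_mul_mul, one_mul, Complex.norm_real]

theorem continuous_Fhat {ψ : ℝ → ℝ} (hψ : Integrable ψ) : Continuous (Fhat ψ) := by
  refine continuous_of_dominated (bound := fun u => ‖ψ u‖) (fun l => ?_)
    (fun l => .of_forall fun u => ?_) hψ.norm (.of_forall fun u => by fun_prop)
  · exact (Continuous.aestronglyMeasurable (by fun_prop)).mul hψ.ofReal.aestronglyMeasurable
  · simp only [norm_mul, norm_exp_neg_I_mul_mul, one_mul, Complex.norm_real, le_refl]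

/-- Lemma 3 (singular integral finiteness): for `β ∈ (0,1)`,
`ν₁, ν₂, ν₃ ∈ (−β, 1−β)` with `ν₁+ν₃ < 1−2β` and `ν₂+ν₃ < 1−2β`,
the integral
`∫ |λ₁|^{ν₁+β−1} |λ₂|^{ν₂+β−1} (∫ |ψ̂(λ₁+ξ)||ψ̂(λ₂−ξ)| |ξ|^{−(1−β−ν₃)} dξ)² dλ₁ dλ₂`
is finite. -/
theorem stmt0 (β ν₁ ν₂ ν₃ : ℝ) (hβ : β ∈ Set.Ioo (0 : ℝ) 1)
    (ψ : ℝ → ℝ) (hψ : Integrable ψ) (hψhat : Integrable (Fhat ψ))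
    (hν₁ : ν₁ ∈ Set.Ioo (-β) (1 - β)) (hν₂ : ν₂ ∈ Set.Ioo (-β) (1 - β))
    (hν₃ : ν₃ ∈ Set.Ioo (-β) (1 - β))
    (h13 : ν₁ + ν₃ < 1 - 2 * β) (h23 : ν₂ + ν₃ < 1 - 2 * β) :
    ∫⁻ p : ℝ × ℝ,
      ENNReal.ofReal (|p.1| ^ (ν₁ + β - 1) * |p.2| ^ (ν₂ + β - 1)) *
        (∫⁻ ξ : ℝ, ENNReal.ofReal
          (‖Fhat ψ (p.1 + ξ)‖ * ‖Fhat ψ (p.2 - ξ)‖ * |ξ| ^ (-(1 - β - ν₃)))) ^ 2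
      < ⊤ := by
  set f : ℝ → ENNReal := fun l => ENNReal.ofReal ‖Fhat ψ l‖
  set k : ℝ → ENNReal := fun ξ => ENNReal.ofReal (|ξ| ^ (ν₃ + β - 1))
  set C : ENNReal := ENNReal.ofReal (∫ u, ‖ψ u‖)
  set P : ℝ → ENNReal := fun x => ∫⁻ ξ, f (x + ξ) * k ξ
  have hf : Measurable f := (continuous_Fhat hψ).norm.measurable.ennreal_ofReal
  have hk : Measurable k := by fun_prop
  have hfC (l : ℝ) : f l ≤ C := ENNReal.ofReal_le_ofReal (norm_Fhat_le ψ l)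
  have hP : Measurable P := Measurable.lintegral_prod_right' (ν := volume)
    (f := fun z : ℝ × ℝ => f (z.1 + z.2) * k z.2) (by fun_prop)
  have hfinite (ν : ℝ) (hν : ν ∈ Set.Ioo (-β) (1 - β)) (h : ν + ν₃ < 1 - 2 * β) :
      ∫⁻ x, ENNReal.ofReal (|x| ^ (ν + β - 1)) * P x < ⊤ :=
    lintegral_rpow_abs_mul_lintegral_lt_top (by linarith [hν.1]) (by linarith [hν.2])
      (by linarith [hν₃.1]) (by linarith [hν₃.2]) (by linarith) hf ENNReal.ofReal_lt_top hfC
      hψhat.norm.lintegral_lt_top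
  have hreflect (y : ℝ) : ∫⁻ ξ, f (y - ξ) * k ξ = P y := by
    rw [← lintegral_neg_eq_self]
    simp [P, k]
  have hpt (p : ℝ × ℝ) :
      ENNReal.ofReal (|p.1| ^ (ν₁ + β - 1) * |p.2| ^ (ν₂ + β - 1)) *
        (∫⁻ ξ : ℝ, ENNReal.ofReal
          (‖Fhat ψ (p.1 + ξ)‖ * ‖Fhat ψ (p.2 - ξ)‖ * |ξ| ^ (-(1 - β - ν₃)))) ^ 2 ≤
      C ^ 2 * ((ENNReal.ofReal (|p.1| ^ (ν₁ + β - 1)) * P p.1) *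
        (ENNReal.ofReal (|p.2| ^ (ν₂ + β - 1)) * P p.2)) := by
    have hξ (ξ : ℝ) : ENNReal.ofReal
        (‖Fhat ψ (p.1 + ξ)‖ * ‖Fhat ψ (p.2 - ξ)‖ * |ξ| ^ (-(1 - β - ν₃))) =
          f (p.1 + ξ) * f (p.2 - ξ) * k ξ := by
      rw [ENNReal.ofReal_mul (by positivity), ENNReal.ofReal_mul (by positivity),
        show -(1 - β - ν₃) = ν₃ + β - 1 by ring]
    simp only [hξ]
    have h₁ : ∫⁻ ξ, f (p.1 + ξ) * f (p.2 - ξ) * k ξ ≤ C * P p.1 := by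
      rw [← lintegral_const_mul _ (by fun_prop)]
      refine lintegral_mono fun ξ => ?_
      calc f (p.1 + ξ) * f (p.2 - ξ) * k ξ ≤ f (p.1 + ξ) * C * k ξ := by gcongr; exact hfC _
        _ = C * (f (p.1 + ξ) * k ξ) := by ring
    have h₂ : ∫⁻ ξ, f (p.1 + ξ) * f (p.2 - ξ) * k ξ ≤ C * P p.2 := by
      rw [← hreflect, ← lintegral_const_mul _ (by fun_prop)]
      refine lintegral_mono fun ξ => ?_
      calc f (p.1 + ξ) * f (p.2 - ξ) * k ξ ≤ C * f (p.2 - ξ) * k ξ := by gcongr; exact hfC _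
        _ = C * (f (p.2 - ξ) * k ξ) := by ring
    rw [ENNReal.ofReal_mul (by positivity), sq (∫⁻ ξ, f (p.1 + ξ) * f (p.2 - ξ) * k ξ)]
    refine (mul_le_mul_right (mul_le_mul' h₁ h₂) _).trans_eq ?_
    ring
  refine (lintegral_mono hpt).trans_lt ?_
  rw [lintegral_const_mul _ (by fun_prop), Measure.volume_eq_prod,
    lintegral_prod_mul (f := fun x => ENNReal.ofReal (|x| ^ (ν₁ + β - 1)) * P x)
      (g := fun y => ENNReal.ofReal (|y| ^ (ν₂ + β - 1)) * P y) (by fun_prop) (by fun_prop)]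
  exact ENNReal.mul_lt_top (ENNReal.pow_lt_top ENNReal.ofReal_lt_top)
    (ENNReal.mul_lt_top (hfinite ν₁ hν₁ h13) (hfinite ν₂ hν₂ h23))
end

section
/- Under the standing assumption on (L, g, τ): for every δ > 0 there exist a constant C > 0 and a threshold s₀ > 0 such that for all s ≥ s₀ and all x with 0 < x ≤ 1, one has | L(s/x)² / L(s)² − 1 | ≤ C · g(s) · x^{−δ}. -/
open Filter

/-- The function `h_τ` is bounded by the logarithm on `[1, ∞)` when `τ ≤ 0`. -/
theorem ite_log_rpow_le_log {τ η : ℝ} (hτ : τ ≤ 0) (hη : 1 ≤ η) :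
    (if τ = 0 then Real.log η else τ⁻¹ * (η ^ τ - 1)) ≤ Real.log η := by
  split_ifs with h
  · exact le_rfl
  · have hneg : τ < 0 := lt_of_le_of_ne hτ h
    have hexp : Real.log η * τ + 1 ≤ η ^ τ := by
      rw [Real.rpow_def_of_pos (by linarith)]
      exact Real.add_one_le_exp _
    rw [inv_mul_eq_div, div_le_iff_of_neg hneg]
    linarith

/-- Lemma A.1: under the standing assumption on `(L, g, τ)` (`L` slowly varying at
infinity and locally bounded near `0`, `g` regularly varying of index `τ ≤ 0` with
`g(s) → 0`, and `|L(ηs)/L(s) − 1| ≤ C₀ g(s) h_τ(η)` for `η ≥ 1`, `s > 0`), for every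
`δ > 0` there exist `C > 0` and `s₀ > 0` such that
`|L(s/x)²/L(s)² − 1| ≤ C g(s) x^{−δ}` for all `s ≥ s₀` and `0 < x ≤ 1`. -/
theorem stmt6 (L g : ℝ → ℝ) (τ : ℝ) (hτ : τ ≤ 0)
    (hLpos : ∀ s : ℝ, 0 < s → 0 < L s)
    (hLslow : ∀ c : ℝ, 0 < c →
      Tendsto (fun s : ℝ => L (c * s) / L s) atTop (nhds 1))
    (hLbdd : ∀ a : ℝ, 0 < a → ∃ M : ℝ, ∀ x ∈ Set.Ioc (0 : ℝ) a, L x ≤ M)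
    (hgpos : ∀ s : ℝ, 0 < s → 0 < g s)
    (hgreg : ∀ c : ℝ, 0 < c →
      Tendsto (fun s : ℝ => g (c * s) / g s) atTop (nhds (c ^ τ)))
    (hgbdd : ∀ a : ℝ, 0 < a → ∃ M : ℝ, ∀ x ∈ Set.Ioc (0 : ℝ) a, g x ≤ M)
    (hg0 : Tendsto g atTop (nhds 0))
    (C₀ : ℝ) (hC₀ : 0 < C₀)
    (hLg : ∀ η : ℝ, 1 ≤ η → ∀ s : ℝ, 0 < s →
      |L (η * s) / L s - 1| ≤
        C₀ * g s * (if τ = 0 then Real.log η else τ⁻¹ * (η ^ τ - 1))) :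
    ∀ δ : ℝ, 0 < δ → ∃ C > (0 : ℝ), ∃ s₀ > (0 : ℝ), ∀ s : ℝ, s₀ ≤ s →
      ∀ x : ℝ, 0 < x → x ≤ 1 →
        |(L (s / x)) ^ 2 / (L s) ^ 2 - 1| ≤ C * g s * x ^ (-δ) := by
  intro δ hδ
  obtain ⟨N, hN⟩ := eventually_atTop.mp (hg0.eventually (ge_mem_nhds one_pos))
  set K : ℝ := C₀ * (2 / δ)
  have hK : 0 < K := by positivity
  refine ⟨K * (2 + K), by positivity, max N 1, by positivity, fun s hs x hx hx1 => ?_⟩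
  have hs0 : 0 < s := one_pos.trans_le ((le_max_right N 1).trans hs)
  have hg1 : g s ≤ 1 := hN s ((le_max_left N 1).trans hs)
  have hg := hgpos s hs0
  have hη : 1 ≤ x⁻¹ := (one_le_inv₀ hx).2 hx1
  set P : ℝ := x⁻¹ ^ (δ / 2)
  have hP : 1 ≤ P := Real.one_le_rpow hη (by positivity)
  have hPsq : P * P = x ^ (-δ) := by
    rw [← Real.rpow_add (by positivity), add_halves, Real.inv_rpow hx.le, Real.rpow_neg hx.le]
  have hlog : Real.log x⁻¹ ≤ 2 / δ * P := by
    have := Real.log_le_rpow_div (x := x⁻¹) (by positivity) (half_pos hδ)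
    calc Real.log x⁻¹ ≤ P / (δ / 2) := this
      _ = 2 / δ * P := by field_simp
  have hdiff : |L (s / x) / L s - 1| ≤ K * g s * P := by
    rw [div_eq_inv_mul s x]
    calc _ ≤ _ := hLg x⁻¹ hη s hs0
      _ ≤ C₀ * g s * (2 / δ * P) := by
        gcongr
        exact (ite_log_rpow_le_log hτ hη).trans hlog
      _ = K * g s * P := by ring
  rw [← div_pow, ← hPsq]
  set u : ℝ := L (s / x) / L s
  have hsum : |u + 1| ≤ (2 + K) * P := by
    have hKP : K * g s * P ≤ K * P := by
      gcongr
      exact mul_le_of_le_one_right hK.le hg1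
    calc |u + 1| = |(u - 1) + 2| := by ring_nf
      _ ≤ |u - 1| + |2| := abs_add_le _ _
      _ ≤ K * P + 2 := by rw [abs_two]; linarith
      _ ≤ (2 + K) * P := by linarith
  calc |u ^ 2 - 1| = |u - 1| * |u + 1| := by rw [← abs_mul]; ring_nf
    _ ≤ K * g s * P * ((2 + K) * P) := by gcongr
    _ = K * (2 + K) * g s * (P * P) := by ring
end

section
/- Let σ ∈ (0,2] and χ > 0, and define L̃(t) = (1 + t^{−σ})^{−χ} for t > 0. Then for all s > 0 and all η ≥ 1, one has | L̃(ηs)/L̃(s) − 1 | ≤ χ · (1 − η^{−σ}) · (1 + s^{σ})^{χ} · s^{−σ(χ+1)}. -/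
/-- On `[1, ∞)` the function `u ↦ u ^ (-χ)` is Lipschitz with constant `χ`. -/
theorem rpow_neg_sub_rpow_neg_le {χ u v : ℝ} (hχ : 0 ≤ χ) (hu : 1 ≤ u) (huv : u ≤ v) :
    u ^ (-χ) - v ^ (-χ) ≤ χ * (v - u) := by
  have hu0 : 0 < u := by linarith
  have hr : 1 ≤ v / u := (one_le_div hu0).2 huv
  have hr0 : 0 < v / u := by linarith
  have hv : v ^ (-χ) = u ^ (-χ) * (v / u) ^ (-χ) := by
    rw [← Real.mul_rpow hu0.le hr0.le, mul_div_cancel₀ _ hu0.ne']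
  have hlog : 1 - χ * Real.log (v / u) ≤ (v / u) ^ (-χ) := by
    rw [Real.rpow_def_of_pos hr0]
    linarith [Real.add_one_le_exp (Real.log (v / u) * -χ)]
  have hle : (v / u) ^ (-χ) ≤ 1 := Real.rpow_le_one_of_one_le_of_nonpos hr (by linarith)
  have hu1 : u ^ (-χ) ≤ 1 := Real.rpow_le_one_of_one_le_of_nonpos hu (by linarith)
  have hdiv : v / u - 1 ≤ v - u := by
    rw [div_sub_one hu0.ne']
    exact div_le_self (by linarith) hu
  calc u ^ (-χ) - v ^ (-χ) = u ^ (-χ) * (1 - (v / u) ^ (-χ)) := by rw [hv]; ring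
    _ ≤ 1 - (v / u) ^ (-χ) := mul_le_of_le_one_left (by linarith) hu1
    _ ≤ χ * Real.log (v / u) := by linarith
    _ ≤ χ * (v - u) := by
      gcongr
      exact (Real.log_le_sub_one_of_pos hr0).trans hdiv

/-- Example 1 (generalized Linnik): for `σ ∈ (0,2]`, `χ > 0` and
`L̃(t) = (1+t^{−σ})^{−χ}`, one has
`|L̃(ηs)/L̃(s) − 1| ≤ χ (1−η^{−σ}) (1+s^σ)^χ s^{−σ(χ+1)}` for all `s > 0`, `η ≥ 1`. -/
theorem stmt8 (σ χ : ℝ) (hσ : σ ∈ Set.Ioc (0 : ℝ) 2) (hχ : 0 < χ)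
    (Lt : ℝ → ℝ) (hLt : ∀ t : ℝ, 0 < t → Lt t = (1 + t ^ (-σ)) ^ (-χ)) :
    ∀ s : ℝ, 0 < s → ∀ η : ℝ, 1 ≤ η →
      |Lt (η * s) / Lt s - 1| ≤
        χ * (1 - η ^ (-σ)) * (1 + s ^ σ) ^ χ * s ^ (-(σ * (χ + 1))) := by
  intro s hs η hη
  have hη0 : 0 < η := by linarith
  rw [hLt _ (mul_pos hη0 hs), hLt s hs, Real.mul_rpow hη0.le hs.le]
  have hx : 0 < s ^ (-σ) := Real.rpow_pos_of_pos hs _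
  have ha : 0 < η ^ (-σ) := Real.rpow_pos_of_pos hη0 _
  have ha1 : η ^ (-σ) ≤ 1 := Real.rpow_le_one_of_one_le_of_nonpos hη (by linarith [hσ.1])
  have hrhs : (1 + s ^ σ) ^ χ * s ^ (-(σ * (χ + 1))) = (1 + s ^ (-σ)) ^ χ * s ^ (-σ) := by
    have hsplit : s ^ (-(σ * (χ + 1))) = (s ^ (-σ)) ^ χ * s ^ (-σ) := by
      rw [← Real.rpow_mul hs.le, ← Real.rpow_add hs]
      ring_nf
    have hcancel : s ^ σ * s ^ (-σ) = 1 := by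
      rw [← Real.rpow_add hs, add_neg_cancel, Real.rpow_zero]
    rw [hsplit, ← mul_assoc, ← Real.mul_rpow (by positivity) hx.le, add_mul, hcancel, one_mul,
      add_comm (s ^ (-σ))]
  rw [mul_assoc, hrhs]
  generalize s ^ (-σ) = x at *
  generalize η ^ (-σ) = a at *
  have hax : 0 < a * x := mul_pos ha hx
  have huv : 1 + a * x ≤ 1 + x := by nlinarith
  have hv : 0 < (1 + x) ^ χ := by positivity
  have hcancel : (1 + x) ^ χ * (1 + x) ^ (-χ) = 1 := by
    rw [← Real.rpow_add (by positivity), add_neg_cancel, Real.rpow_zero]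
  have hlhs : (1 + a * x) ^ (-χ) / (1 + x) ^ (-χ) - 1
      = (1 + x) ^ χ * ((1 + a * x) ^ (-χ) - (1 + x) ^ (-χ)) := by
    rw [mul_sub, hcancel, eq_inv_of_mul_eq_one_right hcancel, div_inv_eq_mul, mul_comm]
  have hmono : (1 + x) ^ (-χ) ≤ (1 + a * x) ^ (-χ) :=
    Real.rpow_le_rpow_of_nonpos (by positivity) huv (by linarith)
  rw [hlhs, abs_of_nonneg (mul_nonneg hv.le (by linarith))]
  calc (1 + x) ^ χ * ((1 + a * x) ^ (-χ) - (1 + x) ^ (-χ))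
      ≤ (1 + x) ^ χ * (χ * (1 + x - (1 + a * x))) := by
        gcongr
        exact rpow_neg_sub_rpow_neg_le hχ.le (by linarith) huv
    _ = χ * (1 - a) * ((1 + x) ^ χ * x) := by ring
end

section
/- Let σ ∈ (0,2] and χ > 0, and define L̃(t) = χ^{−1} t^{σ} ( 1 − (1 + t^{−σ})^{−χ} ) for t > 0. Then (i) L̃(t) → 1 as t → ∞ (so L̃ is slowly varying at infinity), and (ii) there exists a constant C > 0, depending only on σ and χ, such that for all s ≥ 1 and all η ≥ 1, one has | L̃(ηs)/L̃(s) − 1 | ≤ C · σ^{−1}(1 − η^{−σ}) · s^{−σ}. -/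
open Filter

theorem hasDerivAt_one_add_rpow (p x : ℝ) (hx : -1 < x) :
    HasDerivAt (fun y : ℝ => (1 + y) ^ p) (p * (1 + x) ^ (p - 1)) x := by
  have h := ((hasDerivAt_id x).const_add 1).rpow_const (p := p)
    (Or.inl (by simp only [id]; linarith))
  simpa using h

theorem hasDerivAt_one_sub_one_add_rpow_neg (χ x : ℝ) (hx : -1 < x) :
    HasDerivAt (fun y : ℝ => 1 - (1 + y) ^ (-χ)) (χ * (1 + x) ^ (-χ - 1)) x := by
  have h := (hasDerivAt_one_add_rpow (-χ) x hx).const_sub 1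
  simpa using h

theorem hasDerivAt_mul_one_add_rpow (χ x : ℝ) (hx : -1 < x) :
    HasDerivAt (fun y : ℝ => χ * (1 + y) ^ (-χ - 1))
      (-(χ * (χ + 1) * (1 + x) ^ (-χ - 1 - 1))) x := by
  have h := (hasDerivAt_one_add_rpow (-χ - 1) x hx).const_mul χ
  refine h.congr_deriv ?_
  ring

theorem concaveOn_one_sub_one_add_rpow_neg {χ : ℝ} (hχ : 0 < χ) :
    ConcaveOn ℝ (Set.Ici 0) (fun y : ℝ => 1 - (1 + y) ^ (-χ)) := by
  refine concaveOn_of_hasDerivWithinAt2_nonpos (convex_Ici 0)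
    (f' := fun y => χ * (1 + y) ^ (-χ - 1))
    (f'' := fun y => -(χ * (χ + 1) * (1 + y) ^ (-χ - 1 - 1))) ?_ ?_ ?_ ?_
  · intro x hx
    have hx : 0 ≤ x := hx
    exact (hasDerivAt_one_sub_one_add_rpow_neg χ x
      (by linarith)).continuousAt.continuousWithinAt
  · intro x hx
    rw [interior_Ici] at hx
    have hx : 0 < x := hx
    exact (hasDerivAt_one_sub_one_add_rpow_neg χ x (by linarith)).hasDerivWithinAt
  · intro x hx
    rw [interior_Ici] at hx
    have hx : 0 < x := hx
    exact (hasDerivAt_mul_one_add_rpow χ x (by linarith)).hasDerivWithinAt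
  · intro x hx
    rw [interior_Ici] at hx
    have hx : 0 < x := hx
    have : 0 < χ * (χ + 1) * (1 + x) ^ (-χ - 1 - 1) := by positivity
    linarith

theorem convexOn_one_sub_one_add_rpow_neg_add_sq {χ : ℝ} (hχ : 0 < χ) :
    ConvexOn ℝ (Set.Ici 0)
      (fun y : ℝ => 1 - (1 + y) ^ (-χ) + χ * (χ + 1) / 2 * y ^ 2) := by
  have h1 : ∀ x : ℝ, -1 < x →
      HasDerivAt (fun y : ℝ => 1 - (1 + y) ^ (-χ) + χ * (χ + 1) / 2 * y ^ 2)
        (χ * (1 + x) ^ (-χ - 1) + χ * (χ + 1) * x) x := by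
    intro x hx
    refine ((hasDerivAt_one_sub_one_add_rpow_neg χ x hx).add
      ((hasDerivAt_pow 2 x).const_mul (χ * (χ + 1) / 2))).congr_deriv ?_
    norm_num
    ring
  have h2 : ∀ x : ℝ, -1 < x →
      HasDerivAt (fun y : ℝ => χ * (1 + y) ^ (-χ - 1) + χ * (χ + 1) * y)
        (-(χ * (χ + 1) * (1 + x) ^ (-χ - 1 - 1)) + χ * (χ + 1)) x := by
    intro x hx
    refine ((hasDerivAt_mul_one_add_rpow χ x hx).add
      ((hasDerivAt_id x).const_mul (χ * (χ + 1)))).congr_deriv ?_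
    ring
  refine convexOn_of_hasDerivWithinAt2_nonneg (convex_Ici 0)
    (f' := fun y => χ * (1 + y) ^ (-χ - 1) + χ * (χ + 1) * y)
    (f'' := fun y => -(χ * (χ + 1) * (1 + y) ^ (-χ - 1 - 1)) + χ * (χ + 1)) ?_ ?_ ?_ ?_
  · intro x hx
    have hx : 0 ≤ x := hx
    exact (h1 x (by linarith)).continuousAt.continuousWithinAt
  · intro x hx
    rw [interior_Ici] at hx
    have hx : 0 < x := hx
    exact (h1 x (by linarith)).hasDerivWithinAt
  · intro x hx
    rw [interior_Ici] at hx
    have hx : 0 < x := hx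
    exact (h2 x (by linarith)).hasDerivWithinAt
  · intro x hx
    rw [interior_Ici] at hx
    have hx : 0 < x := hx
    have hle : (1 + x) ^ (-χ - 1 - 1) ≤ 1 :=
      Real.rpow_le_one_of_one_le_of_nonpos (by linarith) (by linarith)
    have hpos : 0 < χ * (χ + 1) := by positivity
    nlinarith

theorem tendsto_one_sub_one_add_rpow_neg_div (χ : ℝ) :
    Tendsto (fun x : ℝ => x⁻¹ * (1 - (1 + x) ^ (-χ))) (nhdsWithin 0 (Set.Ioi 0)) (nhds χ) := by
  have h := (hasDerivAt_one_sub_one_add_rpow_neg χ 0 (by norm_num)).tendsto_slope_zero_right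
  simpa using h

/-- Example 2 (Dagum): for `σ ∈ (0,2]`, `χ > 0` and
`L̃(t) = χ^{−1} t^σ (1 − (1+t^{−σ})^{−χ})`, (i) `L̃(t) → 1` as `t → ∞`, and
(ii) there is `C > 0` depending only on `σ, χ` with
`|L̃(ηs)/L̃(s) − 1| ≤ C σ^{−1}(1−η^{−σ}) s^{−σ}` for all `s ≥ 1`, `η ≥ 1`. -/
theorem stmt9 (σ χ : ℝ) (hσ : σ ∈ Set.Ioc (0 : ℝ) 2) (hχ : 0 < χ)
    (Lt : ℝ → ℝ)
    (hLt : ∀ t : ℝ, 0 < t → Lt t = χ⁻¹ * t ^ σ * (1 - (1 + t ^ (-σ)) ^ (-χ))) :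
    Tendsto Lt atTop (nhds 1) ∧
    ∃ C > (0 : ℝ), ∀ s : ℝ, 1 ≤ s → ∀ η : ℝ, 1 ≤ η →
      |Lt (η * s) / Lt s - 1| ≤ C * (σ⁻¹ * (1 - η ^ (-σ))) * s ^ (-σ) := by
  have hσ0 : 0 < σ := hσ.1
  have hLt' : ∀ t : ℝ, 0 < t →
      Lt t = χ⁻¹ * ((t ^ (-σ))⁻¹ * (1 - (1 + t ^ (-σ)) ^ (-χ))) := by
    intro t ht
    rw [hLt t ht, mul_assoc, Real.rpow_neg ht.le, inv_inv]
  constructor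
  · have h0 : Tendsto (fun t : ℝ => t ^ (-σ)) atTop (nhdsWithin 0 (Set.Ioi 0)) :=
      tendsto_nhdsWithin_iff.2 ⟨tendsto_rpow_neg_atTop hσ0,
        (eventually_gt_atTop 0).mono fun t ht => Real.rpow_pos_of_pos ht _⟩
    have h := ((tendsto_one_sub_one_add_rpow_neg_div χ).comp h0).const_mul χ⁻¹
    rw [inv_mul_cancel₀ hχ.ne'] at h
    refine h.congr' ?_
    filter_upwards [eventually_gt_atTop 0] with t ht
    exact (hLt' t ht).symm
  · set f : ℝ → ℝ := fun y => 1 - (1 + y) ^ (-χ) with hf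
    have hf0 : f 0 = 0 := by simp [hf]
    have hlow : ∀ u x : ℝ, 0 ≤ u → u ≤ 1 → 0 ≤ x → u * f x ≤ f (u * x) := by
      intro u x hu hu1 hx
      have h := (concaveOn_one_sub_one_add_rpow_neg hχ).2 (x := x) (y := 0) hx
        Set.self_mem_Ici hu (sub_nonneg.2 hu1) (by ring)
      change u • f x + (1 - u) • f 0 ≤ f (u • x + (1 - u) • 0) at h
      simpa [hf0] using h
    have hup : ∀ u x : ℝ, 0 ≤ u → u ≤ 1 → 0 ≤ x →
        f (u * x) + χ * (χ + 1) / 2 * (u * x) ^ 2 ≤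
          u * (f x + χ * (χ + 1) / 2 * x ^ 2) := by
      intro u x hu hu1 hx
      have h := (convexOn_one_sub_one_add_rpow_neg_add_sq hχ).2 (x := x) (y := 0) hx
        Set.self_mem_Ici hu (sub_nonneg.2 hu1) (by ring)
      simpa [hf] using h
    have hc : 0 < f 1 := by
      have : (1 + 1 : ℝ) ^ (-χ) < 1 :=
        Real.rpow_lt_one_of_one_lt_of_neg (by norm_num) (by linarith)
      simp only [hf]
      linarith
    refine ⟨σ * (χ * (χ + 1) / 2) / f 1, by positivity, fun s hs η hη => ?_⟩
    have hs0 : 0 < s := by linarith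
    have hη0 : 0 < η := by linarith
    rw [hLt' s hs0, hLt' (η * s) (by positivity), Real.mul_rpow hη0.le hs0.le]
    have hx0 : 0 < s ^ (-σ) := by positivity
    have hx1 : s ^ (-σ) ≤ 1 := Real.rpow_le_one_of_one_le_of_nonpos hs (by linarith)
    have hu0 : 0 < η ^ (-σ) := by positivity
    have hu1 : η ^ (-σ) ≤ 1 := Real.rpow_le_one_of_one_le_of_nonpos hη (by linarith)
    generalize s ^ (-σ) = x at *
    generalize η ^ (-σ) = u at *
    change |χ⁻¹ * ((u * x)⁻¹ * f (u * x)) / (χ⁻¹ * (x⁻¹ * f x)) - 1| ≤ _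
    have hfx : x * f 1 ≤ f x := by simpa using hlow x 1 hx0.le hx1 zero_le_one
    have hfx0 : 0 < f x := lt_of_lt_of_le (by positivity) hfx
    have h1 := hlow u x hu0.le hu1 hx0.le
    have h2 := hup u x hu0.le hu1 hx0.le
    have hK : 0 < χ * (χ + 1) / 2 := by positivity
    generalize χ * (χ + 1) / 2 = K at *
    have heq : χ⁻¹ * ((u * x)⁻¹ * f (u * x)) / (χ⁻¹ * (x⁻¹ * f x)) - 1 =
        (f (u * x) - u * f x) / (u * f x) := by
      field_simp
    have heq' : σ * K / f 1 * (σ⁻¹ * (1 - u)) * x = K * (1 - u) * x / f 1 := by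
      field_simp
    rw [heq, heq', abs_of_nonneg (div_nonneg (sub_nonneg.2 h1) (by positivity)),
      div_le_div_iff₀ (by positivity) hc]
    calc (f (u * x) - u * f x) * f 1
        ≤ (K * (1 - u) * x * u * x) * f 1 := by
          refine mul_le_mul_of_nonneg_right ?_ hc.le
          linarith
      _ = K * (1 - u) * x * u * (x * f 1) := by ring
      _ ≤ K * (1 - u) * x * u * f x := by
          refine mul_le_mul_of_nonneg_left hfx ?_
          have := sub_nonneg.2 hu1
          positivity
      _ = K * (1 - u) * x * (u * f x) := by ring
end
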